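/- Let L : ℝⁿ × ℝᵐ → ℝ be twice continuously differentiable and ρ-weakly convex–weakly concave, and let η > max(ρ, 0). Then the Lyapunov function ℒ(x,y) = −e_η{−L(x,·)}(y) − e_η{L(·,y)}(x) satisfies ℒ(x,y) = 0 if and only if (x,y) is a stationary point of L, i.e. ∇L(x,y) = 0. -/

import Mathlib

open Filter Topology Metric
open scoped RealInnerProductSpace

noncomputable section

abbrev Eu (n : ℕ) : Type := EuclideanSpace ℝ (Fin n)

noncomputable def gradx {n m : ℕ} (L : Eu n × Eu m → ℝ) (z : Eu n × Eu m) : Eu n :=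
  gradient (fun u => L (u, z.2)) z.1

noncomputable def grady {n m : ℕ} (L : Eu n × Eu m → ℝ) (z : Eu n × Eu m) : Eu m :=
  gradient (fun v => L (z.1, v)) z.2

noncomputable def Hxx {n m : ℕ} (L : Eu n × Eu m → ℝ) (z : Eu n × Eu m) : Eu n →L[ℝ] Eu n :=
  fderiv ℝ (fun x => gradient (fun u => L (u, z.2)) x) z.1

noncomputable def Hxy {n m : ℕ} (L : Eu n × Eu m → ℝ) (z : Eu n × Eu m) : Eu m →L[ℝ] Eu n :=
  fderiv ℝ (fun y => gradient (fun u => L (u, y)) z.1) z.2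

noncomputable def Hyx {n m : ℕ} (L : Eu n × Eu m → ℝ) (z : Eu n × Eu m) : Eu n →L[ℝ] Eu m :=
  fderiv ℝ (fun x => gradient (fun v => L (x, v)) z.2) z.1

noncomputable def Hyy {n m : ℕ} (L : Eu n × Eu m → ℝ) (z : Eu n × Eu m) : Eu m →L[ℝ] Eu m :=
  fderiv ℝ (fun y => gradient (fun v => L (z.1, v)) y) z.2

def WeaklyConvexConcave {n m : ℕ} (ρ : ℝ) (L : Eu n × Eu m → ℝ) : Prop :=
  ∀ z : Eu n × Eu m,
    (∀ v : Eu n, -ρ * ‖v‖ ^ 2 ≤ ⟪(Hxx L z) v, v⟫) ∧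
    (∀ w : Eu m, ⟪(Hyy L z) w, w⟫ ≤ ρ * ‖w‖ ^ 2)

def IntDomX {n m : ℕ} (η α : ℝ) (L : Eu n × Eu m → ℝ) : Prop :=
  ∀ z : Eu n × Eu m, ∀ v : Eu n,
    α * ‖v‖ ^ 2 ≤
      ⟪(Hxx L z) v +
        (Hxy L z) ((Ring.inverse (η • (1 : Eu m →L[ℝ] Eu m) - Hyy L z)) ((Hyx L z) v)), v⟫

def IntDomY {n m : ℕ} (η α : ℝ) (L : Eu n × Eu m → ℝ) : Prop :=
  ∀ z : Eu n × Eu m, ∀ w : Eu m,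
    α * ‖w‖ ^ 2 ≤
      ⟪-((Hyy L z) w) +
        (Hyx L z) ((Ring.inverse (η • (1 : Eu n →L[ℝ] Eu n) + Hxx L z)) ((Hxy L z) w)), w⟫

noncomputable def proxObj {n m : ℕ} (η : ℝ) (L : Eu n × Eu m → ℝ) (z w : Eu n × Eu m) : ℝ :=
  L w + η / 2 * ‖w.1 - z.1‖ ^ 2 - η / 2 * ‖w.2 - z.2‖ ^ 2

def IsProxPoint {n m : ℕ} (η : ℝ) (L : Eu n × Eu m → ℝ) (z w : Eu n × Eu m) : Prop :=
  (∀ v : Eu m, proxObj η L z (w.1, v) ≤ proxObj η L z w) ∧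
  (∀ u : Eu n, proxObj η L z w ≤ proxObj η L z (u, w.2))

noncomputable def saddleEnv {n m : ℕ} (η : ℝ) (L : Eu n × Eu m → ℝ)
    (prox : Eu n × Eu m → Eu n × Eu m) (z : Eu n × Eu m) : ℝ :=
  proxObj η L z (prox z)

noncomputable def moreau {n : ℕ} (η : ℝ) (f : Eu n → ℝ) (x : Eu n) : ℝ :=
  ⨅ u : Eu n, (f u + η / 2 * ‖u - x‖ ^ 2)

noncomputable def lyap {n m : ℕ} (η : ℝ) (L : Eu n × Eu m → ℝ) (z : Eu n × Eu m) : ℝ :=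
  -(moreau η (fun v => -L (z.1, v)) z.2) - moreau η (fun u => L (u, z.2)) z.1

noncomputable def hessForm {n m : ℕ} (L : Eu n × Eu m → ℝ) (z v w : Eu n × Eu m) : ℝ :=
  ⟪(Hxx L z) v.1, w.1⟫ + ⟪(Hxy L z) v.2, w.1⟫ + ⟪(Hyx L z) v.1, w.2⟫ + ⟪(Hyy L z) v.2, w.2⟫

theorem contDiff_gradient {n : ℕ} {f : Eu n → ℝ} (hf : ContDiff ℝ 2 f) :
    ContDiff ℝ 1 (gradient f) :=
  (InnerProductSpace.toDual ℝ (Eu n)).symm.contDiff.comp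
    (hf.fderiv_right (m := 1) (by norm_num))

theorem gradient_fun_neg {n : ℕ} (f : Eu n → ℝ) :
    gradient (fun u => -f u) = fun u => -gradient f u := by
  funext x
  simp [gradient]

/-- A lower Hessian bound gives the quadratic lower bound on the first-order Taylor remainder. -/
theorem taylor_lower_bound {n : ℕ} {f : Eu n → ℝ} {ρ : ℝ} (hf : ContDiff ℝ 2 f)
    (hρ : ∀ x v : Eu n, -ρ * ‖v‖ ^ 2 ≤ ⟪fderiv ℝ (gradient f) x v, v⟫) (x u : Eu n) :
    f x + ⟪gradient f x, u - x⟫ - ρ / 2 * ‖u - x‖ ^ 2 ≤ f u := by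
  set d := u - x with hd
  have hline (t : ℝ) : HasDerivAt (fun t : ℝ => x + t • d) d t := by
    simpa using ((hasDerivAt_id t).smul_const d).const_add x
  have h₁ (t : ℝ) : HasDerivAt (fun t : ℝ => f (x + t • d) + ρ / 2 * ‖d‖ ^ 2 * t ^ 2)
      (⟪gradient f (x + t • d), d⟫ + ρ * ‖d‖ ^ 2 * t) t := by
    have hg := ((hf.differentiable (by norm_num)) (x + t • d)).hasGradientAt.hasFDerivAt
    have hc := (hg.comp_hasDerivAt t (hline t)).add
      ((hasDerivAt_pow 2 t).const_mul (ρ / 2 * ‖d‖ ^ 2))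
    refine hc.congr_deriv ?_
    simp only [InnerProductSpace.toDual_apply_apply]
    push_cast
    ring
  have h₂ (t : ℝ) : HasDerivAt (fun t : ℝ => ⟪gradient f (x + t • d), d⟫ + ρ * ‖d‖ ^ 2 * t)
      (⟪fderiv ℝ (gradient f) (x + t • d) d, d⟫ + ρ * ‖d‖ ^ 2) t := by
    have hg := (((contDiff_gradient hf).differentiable (by norm_num)) (x + t • d)).hasFDerivAt
    have hc := ((hg.comp_hasDerivAt t (hline t)).inner ℝ (hasDerivAt_const t d)).add
      ((hasDerivAt_id t).const_mul (ρ * ‖d‖ ^ 2))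
    refine hc.congr_deriv ?_
    simp
  have hmono : Monotone (fun t : ℝ => ⟪gradient f (x + t • d), d⟫ + ρ * ‖d‖ ^ 2 * t) := by
    refine monotone_of_deriv_nonneg (fun t => (h₂ t).differentiableAt) fun t => ?_
    rw [(h₂ t).deriv]
    linarith [hρ (x + t • d) d]
  obtain ⟨c, hc, hceq⟩ := exists_hasDerivAt_eq_slope _ _ (zero_lt_one' ℝ)
    (fun t _ => (h₁ t).continuousAt.continuousWithinAt) (fun t _ => h₁ t)
  have hle := hmono hc.1.le
  have hend : x + d = u := by simp [hd]
  simp only [zero_smul, one_smul, add_zero, mul_zero, hend] at hle hceq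
  simp only [one_pow, mul_one, ne_eq, OfNat.ofNat_ne_zero, not_false_eq_true, zero_pow, mul_zero,
    add_zero, sub_zero, div_one] at hceq
  linarith

/-- The Moreau envelope never exceeds the function, and touches it exactly at critical points. -/
theorem moreau_le_and_eq_iff {n : ℕ} {f : Eu n → ℝ} {ρ η : ℝ} (hf : ContDiff ℝ 2 f)
    (hρ : ∀ x v : Eu n, -ρ * ‖v‖ ^ 2 ≤ ⟪fderiv ℝ (gradient f) x v, v⟫) (hη : ρ < η)
    (x : Eu n) :
    moreau η f x ≤ f x ∧ (moreau η f x = f x ↔ gradient f x = 0) := by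
  have hlower (u : Eu n) : f x + ⟪gradient f x, u - x⟫ + (η - ρ) / 2 * ‖u - x‖ ^ 2 ≤
      f u + η / 2 * ‖u - x‖ ^ 2 := by
    linarith [taylor_lower_bound hf hρ x u]
  have hbdd : BddBelow (Set.range fun u => f u + η / 2 * ‖u - x‖ ^ 2) := by
    refine ⟨f x - ‖gradient f x‖ ^ 2 / (2 * (η - ρ)), ?_⟩
    rintro _ ⟨u, rfl⟩
    refine le_trans ?_ (hlower u)
    have hpos : 0 < η - ρ := sub_pos.2 hη
    have hcs := abs_le.1 (abs_real_inner_le_norm (gradient f x) (u - x))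
    have hsq : 0 ≤ (‖gradient f x‖ - (η - ρ) * ‖u - x‖) ^ 2 / (2 * (η - ρ)) := by positivity
    have hexp : (‖gradient f x‖ - (η - ρ) * ‖u - x‖) ^ 2 / (2 * (η - ρ)) =
        ‖gradient f x‖ ^ 2 / (2 * (η - ρ)) - ‖gradient f x‖ * ‖u - x‖ +
          (η - ρ) / 2 * ‖u - x‖ ^ 2 := by
      field_simp
      ring
    linarith [hcs.1]
  have hle : moreau η f x ≤ f x := by
    simpa [moreau] using ciInf_le hbdd x
  refine ⟨hle, fun heq => ?_, fun hgrad => le_antisymm hle (le_ciInf fun u => ?_)⟩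
  · have hmin : IsLocalMin (fun u => f u + η / 2 * ‖u - x‖ ^ 2) x := by
      refine Filter.Eventually.of_forall fun u => ?_
      simpa [← heq, moreau] using ciInf_le hbdd u
    have hg := ((hf.differentiable (by norm_num)) x).hasGradientAt.hasFDerivAt
    have hd := hg.add ((((hasFDerivAt_id x).sub_const x).norm_sq).const_mul (η / 2))
    have hzero := hmin.hasFDerivAt_eq_zero hd
    have hfderiv : fderiv ℝ f x = 0 := by simpa using hzero
    simp [gradient, hfderiv]
  · have hnonneg : 0 ≤ (η - ρ) / 2 * ‖u - x‖ ^ 2 := by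
      have := sub_pos.2 hη
      positivity
    have h := hlower u
    rw [hgrad, inner_zero_left] at h
    linarith

/-- the Lyapunov function vanishes exactly at the stationary
points of L. -/
theorem statement12 {n m : ℕ}
    (L : Eu n × Eu m → ℝ) (ρ η : ℝ)
    (hL : ContDiff ℝ 2 L)
    (hweak : WeaklyConvexConcave ρ L)
    (hη : max ρ 0 < η) :
    ∀ z : Eu n × Eu m, lyap η L z = 0 ↔ (gradx L z = 0 ∧ grady L z = 0) := by
  intro z
  have hη' : ρ < η := (le_max_left ρ 0).trans_lt hη
  have hx := moreau_le_and_eq_iff (f := fun u => L (u, z.2)) (ρ := ρ)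
    (hL.comp (contDiff_id.prodMk contDiff_const)) (fun x v => (hweak (x, z.2)).1 v) hη' z.1
  have hy := moreau_le_and_eq_iff (f := fun v => -L (z.1, v)) (ρ := ρ)
    (hL.comp (contDiff_const.prodMk contDiff_id)).neg
    (fun y w => by
      have h := (hweak (z.1, y)).2 w
      rw [gradient_fun_neg, fderiv_fun_neg, neg_apply, inner_neg_left]
      change ⟪fderiv ℝ (gradient fun v => L (z.1, v)) y w, w⟫ ≤ ρ * ‖w‖ ^ 2 at h
      linarith) hη' z.2
  rw [gradient_fun_neg, neg_eq_zero] at hy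
  rw [gradx, grady, ← hx.2, ← hy.2, lyap]
  have hx' := hx.1
  have hy' := hy.1
  constructor
  · intro h
    constructor <;> linarith
  · rintro ⟨h₁, h₂⟩
    linarith

end
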